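/- Consider a two-player extensive-form game (as in the model below) satisfying perfect recall that is triangle-free. Then the polytope of correlation plans coincides with the von Stengel–Forges polytope: Ξ = 𝒱. -/

import Mathlib

open scoped Classical

/-- The type of "sequences" of a player: `none` is the empty sequence `∅`, and
`some (I, a)` is the sequence consisting of information set `I` (a set of nodes)
together with action `a` at `I`. -/
abbrev SeqP := Option (Set (List ℕ) × ℕ)

/-- The type of (candidate) reduced-normal-form plans: partial functions from
information sets to actions, encoded with `Option`. -/
abbrev PlanT := Set (List ℕ) → Option ℕ

/-- Two information sets (of the two players) are connected, `I ⇌ J`, if some node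
of one is a prefix of some node of the other. -/
def Connected (I J : Set (List ℕ)) : Prop := ∃ u ∈ I, ∃ v ∈ J, u <+: v ∨ v <+: u

/-- A two-player extensive-form game.  Nodes are histories (finite lists of naturals),
`H` is the finite, prefix-closed set of nodes.  The two players are `0` and `1`
(as elements of `Fin 2`, embedded into `Fin 3` via `Fin.castSucc`), and an internal
node `u` with `owner u = 2` is a chance node.  `sim i` is the information-partition
equivalence relation of player `i` on the internal nodes owned by player `i`. -/
structure EFG where
  H : Finset (List ℕ)
  root_mem : ([] : List ℕ) ∈ H
  prefix_closed : ∀ u v : List ℕ, u <+: v → v ∈ H → u ∈ H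
  owner : List ℕ → Fin 3
  sim : Fin 2 → List ℕ → List ℕ → Prop
  sim_mem : ∀ i u v, sim i u v → (∃ a, u ++ [a] ∈ H) ∧ owner u = Fin.castSucc i
  sim_refl : ∀ i u, (∃ a, u ++ [a] ∈ H) → owner u = Fin.castSucc i → sim i u u
  sim_symm : ∀ i u v, sim i u v → sim i v u
  sim_trans : ∀ i u v w, sim i u v → sim i v w → sim i u w
  sim_actions : ∀ i u v, sim i u v → ∀ a : ℕ, u ++ [a] ∈ H ↔ v ++ [a] ∈ H

namespace EFG

variable (G : EFG)

/-- A node is internal if it has at least one child in the tree. -/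
def Internal (u : List ℕ) : Prop := ∃ a, u ++ [a] ∈ G.H

/-- The (finite) set of actions `A(u) = {a : u ++ [a] ∈ H}` available at node `u`. -/
noncomputable def actions (u : List ℕ) : Finset ℕ :=
  (G.H.finite_toSet.preimage (f := fun a : ℕ => u ++ [a])
    (fun a _ b _ hab => by simpa using hab)).toFinset

/-- `I` is an information set of player `i`: an equivalence class of `sim i`. -/
def InfoSet (i : Fin 2) (I : Set (List ℕ)) : Prop :=
  ∃ u, G.sim i u u ∧ I = {v | G.sim i u v}

/-- `seqᵢ(u)`: the list (ordered by increasing length of the prefix `w`) of pairs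
`(I, a)` such that `w ++ [a] ≼ u` for some internal node `w` owned by player `i`
whose information set is `I`. -/
noncomputable def playerSeq (i : Fin 2) (u : List ℕ) : List (Set (List ℕ) × ℕ) :=
  (List.range u.length).filterMap fun k =>
    if G.Internal (u.take k) ∧ G.owner (u.take k) = Fin.castSucc i then
      some ({v | G.sim i (u.take k) v}, u.getD k 0)
    else none

/-- Perfect recall: nodes in the same information set have the same player sequence. -/
def PerfectRecall : Prop := ∀ i u v, G.sim i u v → G.playerSeq i u = G.playerSeq i v

/-- The parent sequence `σ(I)` of an information set `I` of player `i`: the last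
element of `seqᵢ(u)` for `u ∈ I` (`none` encodes the empty sequence `∅`). -/
noncomputable def parentSeq (i : Fin 2) (I : Set (List ℕ)) : SeqP :=
  if h : ∃ u, u ∈ I then (G.playerSeq i h.choose).getLast? else none

/-- All chance moves are public: any two nodes in the same information set have
the same set of chance moves (pairs of a chance node and an action) on their paths. -/
def PublicChance : Prop :=
  ∀ i u v, G.sim i u v →
    {p : List ℕ × ℕ | G.Internal p.1 ∧ G.owner p.1 = 2 ∧ p.1 ++ [p.2] <+: u} =
    {p : List ℕ × ℕ | G.Internal p.1 ∧ G.owner p.1 = 2 ∧ p.1 ++ [p.2] <+: v}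

/-- Triangle-freeness of the game. -/
def TriangleFree : Prop :=
  ¬ ∃ I₁ I₂ J₁ J₂ : Set (List ℕ),
      G.InfoSet 0 I₁ ∧ G.InfoSet 0 I₂ ∧ G.InfoSet 1 J₁ ∧ G.InfoSet 1 J₂ ∧
      I₁ ≠ I₂ ∧ J₁ ≠ J₂ ∧
      G.parentSeq 0 I₁ = G.parentSeq 0 I₂ ∧ G.parentSeq 1 J₁ = G.parentSeq 1 J₂ ∧
      Connected I₁ J₁ ∧ Connected I₂ J₂ ∧ Connected I₁ J₂

/-- `σ` is a member of `Σᵢ`, the set of sequences of player `i`. -/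
def IsSeq (i : Fin 2) (σ : SeqP) : Prop :=
  σ = none ∨ ∃ I a, σ = some (I, a) ∧ G.InfoSet i I ∧ ∃ u ∈ I, u ++ [a] ∈ G.H

/-- `(σ₁, σ₂)` is a relevant sequence pair, `σ₁ ⇌ σ₂`. -/
def RelPair (σ₁ σ₂ : SeqP) : Prop :=
  G.IsSeq 0 σ₁ ∧ G.IsSeq 1 σ₂ ∧
    (σ₁ = none ∨ σ₂ = none ∨
      ∃ I₁ a₁ I₂ a₂, σ₁ = some (I₁, a₁) ∧ σ₂ = some (I₂, a₂) ∧ Connected I₁ I₂)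

/-- `σ₂ ∈ Σ₂` is relevant for the player-1 information set `I₁`. -/
def RelFor₁ (σ₂ : SeqP) (I₁ : Set (List ℕ)) : Prop :=
  σ₂ = none ∨ ∃ I₂ a₂, σ₂ = some (I₂, a₂) ∧ Connected I₁ I₂

/-- `σ₁ ∈ Σ₁` is relevant for the player-2 information set `I₂`. -/
def RelFor₂ (σ₁ : SeqP) (I₂ : Set (List ℕ)) : Prop :=
  σ₁ = none ∨ ∃ I₁ a₁, σ₁ = some (I₁, a₁) ∧ Connected I₁ I₂

/-- The index set of correlation plans: the relevant sequence pairs `Σ₁ ⇌ Σ₂`. -/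
abbrev Idx := {p : SeqP × SeqP // G.RelPair p.1 p.2}

/-- The entry of a vector `v` indexed by relevant pairs at the pair `(σ₁, σ₂)`
(and `0` at irrelevant pairs, which never occur in the constraints below). -/
noncomputable def val (v : G.Idx → ℝ) (σ₁ σ₂ : SeqP) : ℝ :=
  if h : G.RelPair σ₁ σ₂ then v ⟨(σ₁, σ₂), h⟩ else 0

/-- The von Stengel–Forges polytope `𝒱`. -/
def VSF : Set (G.Idx → ℝ) :=
  {v | (∀ p, 0 ≤ v p) ∧
    G.val v none none = 1 ∧
    (∀ I₁, G.InfoSet 0 I₁ → ∀ σ₂, G.IsSeq 1 σ₂ → RelFor₁ σ₂ I₁ → ∀ u ∈ I₁,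
      ∑ a ∈ G.actions u, G.val v (some (I₁, a)) σ₂ = G.val v (G.parentSeq 0 I₁) σ₂) ∧
    (∀ I₂, G.InfoSet 1 I₂ → ∀ σ₁, G.IsSeq 0 σ₁ → RelFor₂ σ₁ I₂ → ∀ u ∈ I₂,
      ∑ a ∈ G.actions u, G.val v σ₁ (some (I₂, a)) = G.val v σ₁ (G.parentSeq 1 I₂))}

/-- `π` is a reduced-normal-form plan for player `i`. -/
def IsPlan (i : Fin 2) (π : PlanT) : Prop :=
  (∀ I, ¬ G.InfoSet i I → π I = none) ∧
  (∀ I, G.InfoSet i I →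
    ((π I).isSome = true ↔ ∀ u ∈ I, ∀ p ∈ G.playerSeq i u, π p.1 = some p.2)) ∧
  (∀ I a, G.InfoSet i I → π I = some a → ∃ u ∈ I, u ++ [a] ∈ G.H)

/-- `Πᵢ(σ)`: the set of reduced-normal-form plans of player `i` compatible with `σ`. -/
def PlanSet (i : Fin 2) : SeqP → Set PlanT
  | none => {π | G.IsPlan i π}
  | some (I, a) => {π | G.IsPlan i π ∧ π I = some a}

/-- `μ` is a probability distribution on `Π₁ × Π₂`. -/
def IsDist (μ : PlanT × PlanT → ℝ) : Prop :=
  (∀ q, 0 ≤ μ q) ∧ (Function.support μ).Finite ∧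
  (∀ q, μ q ≠ 0 → G.IsPlan 0 q.1 ∧ G.IsPlan 1 q.2) ∧
  ∑ᶠ q, μ q = 1

/-- The linear map `f` from distributions on `Π₁ × Π₂` to correlation plans. -/
noncomputable def corrMap (μ : PlanT × PlanT → ℝ) : G.Idx → ℝ :=
  fun p => ∑ᶠ q ∈ {q : PlanT × PlanT | q.1 ∈ G.PlanSet 0 p.1.1 ∧ q.2 ∈ G.PlanSet 1 p.1.2}, μ q

/-- The polytope of correlation plans `Ξ`: the image of the probability distributions
on `Π₁ × Π₂` under `f`. -/
def corrPoly : Set (G.Idx → ℝ) := {x | ∃ μ, G.IsDist μ ∧ x = G.corrMap μ}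

/-- The `σ₁`-rank of a player-2 information set `I₂`: the number of player-1
information sets connected to `I₂` whose parent sequence is `σ₁`. -/
noncomputable def rank₁ (σ₁ : SeqP) (I₂ : Set (List ℕ)) : ℕ :=
  Nat.card {J : Set (List ℕ) // G.InfoSet 0 J ∧ Connected J I₂ ∧ G.parentSeq 0 J = σ₁}

/-- The `σ₂`-rank of a player-1 information set `I₁`: the number of player-2
information sets connected to `I₁` whose parent sequence is `σ₂`. -/
noncomputable def rank₂ (σ₂ : SeqP) (I₁ : Set (List ℕ)) : ℕ :=
  Nat.card {J : Set (List ℕ) // G.InfoSet 1 J ∧ Connected I₁ J ∧ G.parentSeq 1 J = σ₂}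

end EFG

/-- The point-mass distribution `𝟙_{q₀}` on pairs of plans. -/
noncomputable def pointMass (q₀ : PlanT × PlanT) : PlanT × PlanT → ℝ :=
  fun q => if q = q₀ then 1 else 0

/-- A finite forest of decision points: `par I` is the last (decision point, action) pair
preceding `I`. -/
structure InfoForest (α : Type*) where
  nodes : Set α
  finite_nodes : nodes.Finite
  act : α → Set ℕ
  par : α → Option (α × ℕ)
  depth : α → ℕ
  depth_of_par_none : ∀ I ∈ nodes, par I = none → depth I = 0
  of_par_some : ∀ I ∈ nodes, ∀ K c, par I = some (K, c) →
    K ∈ nodes ∧ c ∈ act K ∧ depth I = depth K + 1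

namespace InfoForest

variable {α : Type*} (F : InfoForest α)

/-- `σ` is the empty sequence or a legal (decision point, action) pair. -/
def IsSeq (σ : Option (α × ℕ)) : Prop := ∀ I a, σ = some (I, a) → I ∈ F.nodes ∧ a ∈ F.act I

/-- The partial choice `π` plays the sequence `σ`. -/
def Plays (π : α → Option ℕ) (σ : Option (α × ℕ)) : Prop := ∀ I a, σ = some (I, a) → π I = some a

/-- `π` makes legal choices, and only at decision points which it reaches. -/
def IsPartialPlan (π : α → Option ℕ) : Prop :=
  ∀ I a, π I = some a → I ∈ F.nodes ∧ a ∈ F.act I ∧ Plays π (F.par I)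

/-- `I` is reached by `π`, but `π` does not choose an action there yet. -/
def IsFrontier (π : α → Option ℕ) (I : α) : Prop :=
  I ∈ F.nodes ∧ π I = none ∧ Plays π (F.par I)

variable {F}

lemma par_eq_none {I : α} (hI : I ∈ F.nodes) (h : F.depth I = 0) : F.par I = none := by
  rcases hp : F.par I with _ | ⟨K, c⟩
  · rfl
  · have := (F.of_par_some I hI K c hp).2.2
    omega

lemma isSeq_par {I : α} (hI : I ∈ F.nodes) : F.IsSeq (F.par I) := fun K c h =>
  ⟨(F.of_par_some I hI K c h).1, (F.of_par_some I hI K c h).2.1⟩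

lemma IsPartialPlan.isSeq {π : α → Option ℕ} (h : F.IsPartialPlan π) {σ : Option (α × ℕ)}
    (hσ : Plays π σ) : F.IsSeq σ := fun I a e =>
  ⟨(h I a (hσ I a e)).1, (h I a (hσ I a e)).2.1⟩

lemma Plays.update {π : α → Option ℕ} {σ : Option (α × ℕ)} (hσ : Plays π σ) {I : α}
    (hI : π I = none) (a : ℕ) : Plays (Function.update π I (some a)) σ := by
  intro K c e
  have := hσ K c e
  have hne : K ≠ I := by rintro rfl; simp [hI] at this
  rwa [Function.update_of_ne hne]

lemma IsPartialPlan.update {π : α → Option ℕ} (h : F.IsPartialPlan π) {I : α}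
    (hI : F.IsFrontier π I) {a : ℕ} (ha : a ∈ F.act I) :
    F.IsPartialPlan (Function.update π I (some a)) := by
  intro K c e
  by_cases hK : K = I
  · subst hK
    rw [Function.update_self, Option.some.injEq] at e
    subst e
    exact ⟨hI.1, ha, hI.2.2.update hI.2.1 _⟩
  · rw [Function.update_of_ne hK] at e
    exact ⟨(h K c e).1, (h K c e).2.1, (h K c e).2.2.update hI.2.1 _⟩

end InfoForest

open InfoForest in
/-- Two forests linked by a relation `R` that is inherited by parents and has no path of length
three between siblings, with a set `S` of supported pairs of sequences. -/
structure ForestPair (α β : Type*) where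
  L : InfoForest α
  M : InfoForest β
  R : α → β → Prop
  R_left : ∀ I ∈ L.nodes, ∀ K c J, L.par I = some (K, c) → R I J → R K J
  R_right : ∀ J ∈ M.nodes, ∀ K c I, M.par J = some (K, c) → R I J → R I K
  triangleFree : ∀ I₁ ∈ L.nodes, ∀ I₂ ∈ L.nodes, ∀ J₁ ∈ M.nodes, ∀ J₂ ∈ M.nodes,
    L.par I₁ = L.par I₂ → M.par J₁ = M.par J₂ → R I₁ J₁ → R I₂ J₂ → R I₁ J₂ → I₁ = I₂ ∨ J₁ = J₂
  S : Option (α × ℕ) → Option (β × ℕ) → Prop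
  S_left : ∀ I ∈ L.nodes, ∀ τ, M.IsSeq τ → (∀ J b, τ = some (J, b) → R I J) →
    (S (L.par I) τ ↔ ∃ a ∈ L.act I, S (some (I, a)) τ)
  S_right : ∀ J ∈ M.nodes, ∀ σ, L.IsSeq σ → (∀ I a, σ = some (I, a) → R I J) →
    (S σ (M.par J) ↔ ∃ b ∈ M.act J, S σ (some (J, b)))

namespace ForestPair

open InfoForest

variable {α β : Type*}

/-- Exchange the roles of the two forests. -/
def flip (P : ForestPair α β) : ForestPair β α where
  L := P.M
  M := P.L
  R J I := P.R I J
  R_left := P.R_right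
  R_right := P.R_left
  triangleFree J₁ hJ₁ J₂ hJ₂ I₁ hI₁ I₂ hI₂ hJ hI h₁ h₂ h₃ :=
    (P.triangleFree I₂ hI₂ I₁ hI₁ J₂ hJ₂ J₁ hJ₁ hI.symm hJ.symm h₂ h₁ h₃).symm.imp Eq.symm Eq.symm
  S τ σ := P.S σ τ
  S_left := P.S_right
  S_right := P.S_left

/-- The pair of partial choices `(π, ρ)` is supported, and any undecided point which is reached is
linked to at most one decided point of each depth in the other forest. -/
structure IsState (P : ForestPair α β) (π : α → Option ℕ) (ρ : β → Option ℕ) : Prop where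
  left : P.L.IsPartialPlan π
  right : P.M.IsPartialPlan ρ
  inv_left : ∀ J, P.M.IsFrontier ρ J → ∀ I I', π I ≠ none → π I' ≠ none → P.R I J → P.R I' J →
    P.L.depth I = P.L.depth I' → I = I'
  inv_right : ∀ I, P.L.IsFrontier π I → ∀ J J', ρ J ≠ none → ρ J' ≠ none → P.R I J → P.R I J' →
    P.M.depth J = P.M.depth J' → J = J'
  supported : ∀ σ τ, Plays π σ → Plays ρ τ →
    (∀ I a J b, σ = some (I, a) → τ = some (J, b) → P.R I J) → P.S σ τ

variable {P : ForestPair α β} {π : α → Option ℕ} {ρ : β → Option ℕ}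

lemma IsState.flip (h : P.IsState π ρ) : P.flip.IsState ρ π where
  left := h.right
  right := h.left
  inv_left := h.inv_right
  inv_right := h.inv_left
  supported τ σ hτ hσ hR := h.supported σ τ hσ hτ fun I a J b e e' => hR J b I a e' e

/-- Decided points have decided ancestors at every smaller depth. -/
lemma exists_ancestor (h : P.L.IsPartialPlan π) {I : α} {a : ℕ} (hI : π I = some a) {n : ℕ}
    (hn : n ≤ P.L.depth I) :
    ∃ K c, π K = some c ∧ P.L.depth K = n ∧ (∀ J, P.R I J → P.R K J) ∧
      ∀ τ, P.M.IsSeq τ → (∀ J b, τ = some (J, b) → P.R I J) →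
        P.S (some (I, a)) τ → P.S (some (K, c)) τ := by
  induction hd : P.L.depth I - n generalizing I a with
  | zero => exact ⟨I, a, hI, by omega, fun _ => id, fun _ _ _ => id⟩
  | succ m ih =>
    obtain ⟨hIn, haI, hpl⟩ := h I a hI
    rcases hp : P.L.par I with _ | ⟨Q, q⟩
    · have := P.L.depth_of_par_none I hIn hp
      omega
    · obtain ⟨-, -, hdep⟩ := P.L.of_par_some I hIn Q q hp
      obtain ⟨K, c, hK, hKn, hR, hS⟩ := ih (hpl Q q hp) (by omega) (by omega)
      have hRQ : ∀ J, P.R I J → P.R Q J := fun J => P.R_left I hIn Q q J hp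
      refine ⟨K, c, hK, hKn, fun J hJ => hR J (hRQ J hJ), fun τ hτ hIτ hs => ?_⟩
      refine hS τ hτ (fun J b e => hRQ J (hIτ J b e)) ?_
      rw [← hp]
      exact (P.S_left I hIn τ hτ hIτ).2 ⟨a, haI, hs⟩

lemma S_none_left {σ : Option (α × ℕ)} {τ : Option (β × ℕ)} (hσ : P.L.IsSeq σ) (hτ : P.M.IsSeq τ)
    (hR : ∀ I a J b, σ = some (I, a) → τ = some (J, b) → P.R I J) (hS : P.S σ τ) :
    P.S none τ := by
  rcases σ with _ | ⟨I, a⟩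
  · exact hS
  induction hd : P.L.depth I using Nat.strong_induction_on generalizing I a with
  | _ n ih =>
    obtain ⟨hI, ha⟩ := hσ I a rfl
    have hS' := (P.S_left I hI τ hτ fun J b e => hR I a J b rfl e).2 ⟨a, ha, hS⟩
    rcases hp : P.L.par I with _ | ⟨K, c⟩
    · rwa [hp] at hS'
    · have hs := P.L.of_par_some I hI K c hp
      rw [hp] at hS'
      refine ih _ (by omega) K c (hp ▸ isSeq_par hI) ?_ hS' rfl
      rintro _ _ J b ⟨⟩ e
      exact P.R_left I hI K c J hp (hR I a J b rfl e)

lemma S_none_none {σ : Option (α × ℕ)} {τ : Option (β × ℕ)} (hσ : P.L.IsSeq σ)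
    (hτ : P.M.IsSeq τ) (hR : ∀ I a J b, σ = some (I, a) → τ = some (J, b) → P.R I J)
    (hS : P.S σ τ) : P.S none none :=
  S_none_left (P := P.flip) (σ := τ) (τ := none) hτ (by rintro _ _ ⟨⟩) (by rintro _ _ _ _ _ ⟨⟩)
    (S_none_left hσ hτ hR hS)

/-- Among the sequences played by `ρ` and relevant for a reached undecided `I`, one is a
bottleneck. -/
lemma IsState.exists_bottleneck (h : P.IsState π ρ) {I : α} (hI : P.L.IsFrontier π I) :
    ∃ τ₀, Plays ρ τ₀ ∧ (∀ J b, τ₀ = some (J, b) → P.R I J) ∧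
      ∀ a ∈ P.L.act I, P.S (some (I, a)) τ₀ → ∀ τ, Plays ρ τ →
        (∀ J b, τ = some (J, b) → P.R I J) → P.S (some (I, a)) τ := by
  have hfin : {J | ρ J ≠ none ∧ P.R I J}.Finite := by
    refine P.M.finite_nodes.subset fun J hJ => ?_
    obtain ⟨b, hb⟩ := Option.ne_none_iff_exists'.1 hJ.1
    exact (h.right J b hb).1
  rcases Set.eq_empty_or_nonempty {J | ρ J ≠ none ∧ P.R I J} with he | hne
  · refine ⟨none, by rintro _ _ ⟨⟩, by rintro _ _ ⟨⟩, fun a _ hS τ hτ hR => ?_⟩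
    rcases τ with _ | ⟨J, b⟩
    · exact hS
    · have hJ : J ∈ {J | ρ J ≠ none ∧ P.R I J} := ⟨by simp [hτ J b rfl], hR J b rfl⟩
      simp [he] at hJ
  · obtain ⟨J, ⟨hJ, hIJ⟩, hmax⟩ := hfin.exists_maximalFor P.M.depth _ hne
    obtain ⟨b, hb⟩ := Option.ne_none_iff_exists'.1 hJ
    refine ⟨some (J, b), by rintro _ _ ⟨⟩; exact hb, by rintro _ _ ⟨⟩; exact hIJ,
      fun a ha hS τ hτ hR => ?_⟩
    have hseq : P.L.IsSeq (some (I, a)) := by rintro _ _ ⟨⟩; exact ⟨hI.1, ha⟩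
    rcases τ with _ | ⟨J', b'⟩
    · exact S_none_left (P := P.flip) (σ := some (J, b)) (τ := some (I, a))
        (by rintro _ _ ⟨⟩; exact ⟨(h.right J b hb).1, (h.right J b hb).2.1⟩) hseq
        (by rintro _ _ _ _ ⟨⟩ ⟨⟩; exact hIJ) hS
    · have hJ' : ρ J' = some b' := hτ J' b' rfl
      have hIJ' : P.R I J' := hR J' b' rfl
      have hle : P.M.depth J' ≤ P.M.depth J := by
        by_contra hlt
        exact hlt (hmax (j := J') ⟨by simp [hJ'], hIJ'⟩ (by omega))
      obtain ⟨K, c, hK, hKd, hKR, hKS⟩ := exists_ancestor (P := P.flip) h.right hb hle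
      have hKJ : K = J' :=
        h.inv_right I hI K J' (by simp [hK]) (by simp [hJ']) (hKR I hIJ) hIJ' hKd
      subst hKJ
      rw [hK, Option.some.injEq] at hJ'
      subst hJ'
      exact hKS (some (I, a)) hseq (by rintro _ _ ⟨⟩; exact hIJ) hS

lemma IsState.extend (h : P.IsState π ρ) {I : α} (hI : P.L.IsFrontier π I)
    (hub : ∀ J, P.M.IsFrontier ρ J → P.R I J → ∀ I', π I' ≠ none → P.R I' J →
      P.L.depth I' ≠ P.L.depth I) :
    ∃ a, P.IsState (Function.update π I (some a)) ρ := by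
  obtain ⟨τ₀, hτ₀, hIτ₀, hbot⟩ := h.exists_bottleneck hI
  have hpar : P.S (P.L.par I) τ₀ := h.supported _ _ hI.2.2 hτ₀ fun K c J b e e' =>
    P.R_left I hI.1 K c J e (hIτ₀ J b e')
  obtain ⟨a, ha, hS⟩ := (P.S_left I hI.1 τ₀ (h.right.isSeq hτ₀) hIτ₀).1 hpar
  refine ⟨a, h.left.update hI ha, h.right, ?_, ?_, ?_⟩
  · intro J hJ I₁ I₂ h₁ h₂ hR₁ hR₂ hd
    by_cases e₁ : I₁ = I <;> by_cases e₂ : I₂ = I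
    · rw [e₁, e₂]
    · subst e₁
      rw [Function.update_of_ne e₂] at h₂
      exact absurd hd.symm (hub J hJ hR₁ I₂ h₂ hR₂)
    · subst e₂
      rw [Function.update_of_ne e₁] at h₁
      exact absurd hd (hub J hJ hR₂ I₁ h₁ hR₁)
    · rw [Function.update_of_ne e₁] at h₁
      rw [Function.update_of_ne e₂] at h₂
      exact h.inv_left J hJ I₁ I₂ h₁ h₂ hR₁ hR₂ hd
  · rintro K ⟨hK, hKn, hKp⟩ J J' hJ hJ' hR hR' hd
    have hKI : K ≠ I := by rintro rfl; simp at hKn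
    rw [Function.update_of_ne hKI] at hKn
    rcases hp : P.L.par K with _ | ⟨Q, q⟩
    · exact h.inv_right K ⟨hK, hKn, by rw [hp]; rintro _ _ ⟨⟩⟩ J J' hJ hJ' hR hR' hd
    · by_cases hQ : Q = I
      · subst hQ
        exact h.inv_right Q hI J J' hJ hJ' (P.R_left K hK Q q J hp hR)
          (P.R_left K hK Q q J' hp hR') hd
      · have := hKp Q q hp
        rw [Function.update_of_ne hQ] at this
        exact h.inv_right K ⟨hK, hKn, by rw [hp]; rintro _ _ ⟨⟩; exact this⟩ J J' hJ hJ' hR hR' hd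
  · intro σ τ hσ hτ hR
    rcases σ with _ | ⟨K, c⟩
    · exact h.supported _ τ (by rintro _ _ ⟨⟩) hτ hR
    · have hKc := hσ K c rfl
      by_cases hK : K = I
      · subst hK
        rw [Function.update_self, Option.some.injEq] at hKc
        subst hKc
        exact hbot a ha hS τ hτ fun J b e => hR _ _ _ _ rfl e
      · rw [Function.update_of_ne hK] at hKc
        exact h.supported _ τ (by rintro _ _ ⟨⟩; exact hKc) hτ hR

/-- Reached points of equal depth which are linked to a common undecided point are siblings. -/
lemma IsState.par_eq (h : P.IsState π ρ) {A B : α} {J : β} (hJ : P.M.IsFrontier ρ J)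
    (hA : A ∈ P.L.nodes) (hB : B ∈ P.L.nodes) (hpA : Plays π (P.L.par A))
    (hpB : Plays π (P.L.par B)) (hAJ : P.R A J) (hBJ : P.R B J)
    (hd : P.L.depth A = P.L.depth B) : P.L.par A = P.L.par B := by
  rcases hp : P.L.par A with _ | ⟨Q, q⟩
  · have := P.L.depth_of_par_none A hA hp
    exact (par_eq_none hB (by omega)).symm
  · have hdA := (P.L.of_par_some A hA Q q hp).2.2
    rcases hp' : P.L.par B with _ | ⟨Q', q'⟩
    · have := P.L.depth_of_par_none B hB hp'
      omega
    · have hdB := (P.L.of_par_some B hB Q' q' hp').2.2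
      have hq := hpA Q q hp
      have hq' := hpB Q' q' hp'
      obtain rfl : Q = Q' := h.inv_left J hJ Q Q' (by simp [hq]) (by simp [hq'])
        (P.R_left A hA Q q J hp hAJ) (P.R_left B hB Q' q' J hp' hBJ) (by omega)
      rw [hq, Option.some.injEq] at hq'
      rw [hq']

/-- If `I'` is decided and linked to the undecided `J`, and deciding `J` is obstructed by the
undecided `K`, then `K` is deeper than `I'`. -/
lemma IsState.depth_lt (h : P.IsState π ρ) {I' K : α} {J J' : β} (hJ : P.M.IsFrontier ρ J)
    (hI' : π I' ≠ none) (hI'J : P.R I' J) (hK : P.L.IsFrontier π K) (hKJ : P.R K J)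
    (hJ' : ρ J' ≠ none) (hKJ' : P.R K J') (hd : P.M.depth J' = P.M.depth J) :
    P.L.depth I' < P.L.depth K := by
  by_contra! hle
  obtain ⟨a, ha⟩ := Option.ne_none_iff_exists'.1 hI'
  obtain ⟨b, hb⟩ := Option.ne_none_iff_exists'.1 hJ'
  obtain ⟨Q, c, hQ, hQd, hQR, -⟩ := exists_ancestor h.left ha hle
  have hQl := h.left Q c hQ
  have hJl := h.right J' b hb
  have hQJ := hQR J hI'J
  rcases P.triangleFree K hK.1 Q hQl.1 J' hJl.1 J hJ.1
    (h.par_eq hJ hK.1 hQl.1 hK.2.2 hQl.2.2 hKJ hQJ hQd.symm)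
    (h.flip.par_eq (J := K) hK hJl.1 hJ.1 hJl.2.2 hJ.2.2 hKJ' hKJ hd) hKJ' hQJ hKJ with e | e
  · rw [← e, hK.2.1] at hQ
    cases hQ
  · exact hJ' (e ▸ hJ.2.1)

lemma IsState.exists_extend (h : P.IsState π ρ)
    (hf : (∃ I, P.L.IsFrontier π I) ∨ ∃ J, P.M.IsFrontier ρ J) :
    (∃ I a, P.L.IsFrontier π I ∧ P.IsState (Function.update π I (some a)) ρ) ∨
      ∃ J b, P.M.IsFrontier ρ J ∧ P.IsState π (Function.update ρ J (some b)) := by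
  by_cases hL : ∃ I, P.L.IsFrontier π I
  · have hfin : {I | P.L.IsFrontier π I}.Finite := P.L.finite_nodes.subset fun I hI => hI.1
    obtain ⟨I, hI, hmax⟩ := hfin.exists_maximalFor P.L.depth _ hL
    by_cases hub : ∀ J, P.M.IsFrontier ρ J → P.R I J → ∀ I', π I' ≠ none → P.R I' J →
      P.L.depth I' ≠ P.L.depth I
    · obtain ⟨a, ha⟩ := h.extend hI hub
      exact .inl ⟨I, a, hI, ha⟩
    · push Not at hub
      obtain ⟨J, hJ, -, I', hI', hI'J, hd⟩ := hub
      obtain ⟨b, hb⟩ := h.flip.extend (I := J) hJ fun K hK hKJ J' hJ' hKJ' hdJ => by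
        have hlt := h.depth_lt hJ hI' hI'J hK hKJ hJ' hKJ' hdJ
        have := hmax (j := K) hK (by omega)
        omega
      exact .inr ⟨J, b, hJ, hb.flip⟩
  · obtain ⟨J, hJ⟩ := hf.resolve_left hL
    obtain ⟨b, hb⟩ := h.flip.extend (I := J) hJ fun K hK => absurd ⟨K, hK⟩ hL
    exact .inr ⟨J, b, hJ, hb.flip⟩

lemma ncard_undecided_update_lt {F : InfoForest α} {I : α} (hI : F.IsFrontier π I) (a : ℕ) :
    {K ∈ F.nodes | Function.update π I (some a) K = none}.ncard <
      {K ∈ F.nodes | π K = none}.ncard := by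
  refine Set.ncard_lt_ncard ⟨fun K hK => ?_, fun hss => ?_⟩
    (F.finite_nodes.subset (Set.sep_subset _ _))
  · have hne : K ≠ I := by rintro rfl; simp at hK
    exact ⟨hK.1, by rw [← hK.2, Function.update_of_ne hne]⟩
  · simpa using (hss (show I ∈ {K ∈ F.nodes | π K = none} from ⟨hI.1, hI.2.1⟩)).2

lemma IsState.exists_complete (h : P.IsState π ρ) :
    ∃ π' ρ', P.IsState π' ρ' ∧ (∀ I, ¬ P.L.IsFrontier π' I) ∧ ∀ J, ¬ P.M.IsFrontier ρ' J := by
  induction hn : {K ∈ P.L.nodes | π K = none}.ncard + {K ∈ P.M.nodes | ρ K = none}.ncard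
    using Nat.strong_induction_on generalizing π ρ with
  | _ n ih =>
    by_cases hf : (∃ I, P.L.IsFrontier π I) ∨ ∃ J, P.M.IsFrontier ρ J
    · rcases h.exists_extend hf with ⟨I, a, hI, hs⟩ | ⟨J, b, hJ, hs⟩
      · have := ncard_undecided_update_lt hI a
        exact ih _ (by omega) hs rfl
      · have := ncard_undecided_update_lt hJ b
        exact ih _ (by omega) hs rfl
    · push Not at hf
      exact ⟨π, ρ, h, hf.1, hf.2⟩

/-- If the pair of empty sequences is supported, then so is some pair of complete plans. -/
theorem exists_supported_plans (h : P.S none none) :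
    ∃ π ρ, P.IsState π ρ ∧ (∀ I, ¬ P.L.IsFrontier π I) ∧ ∀ J, ¬ P.M.IsFrontier ρ J := by
  refine IsState.exists_complete (π := fun _ => none) (ρ := fun _ => none)
    ⟨by rintro _ _ ⟨⟩, by rintro _ _ ⟨⟩, by simp, by simp, ?_⟩
  rintro (_ | ⟨I, a⟩) (_ | ⟨J, b⟩) hσ hτ -
  · exact h
  · cases hτ J b rfl
  · cases hσ I a rfl
  · cases hσ I a rfl

end ForestPair

namespace EFG

variable {G : EFG}

lemma InfoSet.eq_of_mem {i : Fin 2} {I : Set (List ℕ)} (hI : G.InfoSet i I) {u : List ℕ}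
    (hu : u ∈ I) : I = {v | G.sim i u v} := by
  obtain ⟨w, -, rfl⟩ := hI
  ext v
  exact ⟨fun hv => G.sim_trans i u w v (G.sim_symm i w u hu) hv, fun hv => G.sim_trans i w u v hu hv⟩

lemma InfoSet.nonempty {i : Fin 2} {I : Set (List ℕ)} (hI : G.InfoSet i I) : I.Nonempty := by
  obtain ⟨w, hw, rfl⟩ := hI
  exact ⟨w, hw⟩

lemma InfoSet.sim {i : Fin 2} {I : Set (List ℕ)} (hI : G.InfoSet i I) {u v : List ℕ}
    (hu : u ∈ I) (hv : v ∈ I) : G.sim i u v := by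
  rw [hI.eq_of_mem hu] at hv
  exact hv

lemma mem_actions {u : List ℕ} {a : ℕ} : a ∈ G.actions u ↔ u ++ [a] ∈ G.H := by
  simp [actions]

lemma playerSeq_append_singleton (i : Fin 2) (u : List ℕ) (x : ℕ) :
    G.playerSeq i (u ++ [x]) = G.playerSeq i u ++
      if G.Internal u ∧ G.owner u = Fin.castSucc i then [({v | G.sim i u v}, x)] else [] := by
  unfold playerSeq
  rw [List.length_append, List.length_singleton, List.range_succ, List.filterMap_append]
  congr 1
  · refine List.filterMap_congr fun k hk => ?_
    have hk' : k < u.length := List.mem_range.1 hk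
    rw [List.take_append_of_le_length hk'.le]
    simp [List.getD, List.getElem?_append_left hk']
  · by_cases h : G.Internal u ∧ G.owner u = Fin.castSucc i <;> simp [h]

/-- The last entry of a player's sequence comes from the last node of that player on the path. -/
lemma exists_of_playerSeq_ne_nil (i : Fin 2) (u : List ℕ) (h : G.playerSeq i u ≠ []) :
    ∃ w x, w ++ [x] <+: u ∧ G.Internal w ∧ G.owner w = Fin.castSucc i ∧
      G.playerSeq i u = G.playerSeq i w ++ [({v | G.sim i w v}, x)] := by
  induction u using List.reverseRecOn with
  | nil => simp [playerSeq] at h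
  | append_singleton u x ih =>
    rw [playerSeq_append_singleton] at h ⊢
    by_cases hc : G.Internal u ∧ G.owner u = Fin.castSucc i
    · exact ⟨u, x, List.prefix_rfl, hc.1, hc.2, by simp [hc]⟩
    · simp only [hc, if_false, List.append_nil] at h ⊢
      obtain ⟨w, y, hw, h'⟩ := ih h
      exact ⟨w, y, hw.trans (List.prefix_append _ _), h'⟩

lemma parentSeq_eq (hpr : G.PerfectRecall) {i : Fin 2} {I : Set (List ℕ)} (hI : G.InfoSet i I)
    {u : List ℕ} (hu : u ∈ I) : G.parentSeq i I = (G.playerSeq i u).getLast? := by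
  have h : ∃ u, u ∈ I := ⟨u, hu⟩
  rw [parentSeq, dif_pos h, hpr i _ u (hI.sim h.choose_spec hu)]

lemma mem_H_of_mem_infoSet {i : Fin 2} {I : Set (List ℕ)} (hI : G.InfoSet i I) {u : List ℕ}
    (hu : u ∈ I) : u ∈ G.H := by
  obtain ⟨a, ha⟩ := (G.sim_mem i u u (hI.sim hu hu)).1
  exact G.prefix_closed _ _ (List.prefix_append _ _) ha

lemma playerSeq_of_parentSeq_none (hpr : G.PerfectRecall) {i : Fin 2} {I : Set (List ℕ)}
    (hI : G.InfoSet i I) (hp : G.parentSeq i I = none) {u : List ℕ} (hu : u ∈ I) :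
    G.playerSeq i u = [] := by
  rw [parentSeq_eq hpr hI hu] at hp
  simpa using hp

lemma parentSeq_some (hpr : G.PerfectRecall) {i : Fin 2} {I K : Set (List ℕ)} {c : ℕ}
    (hI : G.InfoSet i I) (hp : G.parentSeq i I = some (K, c)) {u : List ℕ} (hu : u ∈ I) :
    G.InfoSet i K ∧ ∃ w ∈ K, w ++ [c] <+: u ∧ w ++ [c] ∈ G.H ∧
      G.playerSeq i u = G.playerSeq i w ++ [(K, c)] := by
  rw [parentSeq_eq hpr hI hu] at hp
  have hne : G.playerSeq i u ≠ [] := by rintro h; simp [h] at hp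
  obtain ⟨w, x, hwx, hw, ho, hs⟩ := exists_of_playerSeq_ne_nil i u hne
  rw [hs, List.getLast?_concat, Option.some.injEq, Prod.mk.injEq] at hp
  obtain ⟨rfl, rfl⟩ := hp
  have hww := G.sim_refl i w hw ho
  exact ⟨⟨w, hww, rfl⟩, w, hww, hwx, G.prefix_closed _ _ hwx (mem_H_of_mem_infoSet hI hu), hs⟩

lemma connected_symm {I J : Set (List ℕ)} (h : Connected I J) : Connected J I := by
  obtain ⟨u, hu, v, hv, h⟩ := h
  exact ⟨v, hv, u, hu, h.symm⟩

lemma connected_parent (hpr : G.PerfectRecall) {i : Fin 2} {I K J : Set (List ℕ)} {c : ℕ}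
    (hI : G.InfoSet i I) (hp : G.parentSeq i I = some (K, c)) (h : Connected I J) :
    Connected K J := by
  obtain ⟨u, hu, v, hv, huv⟩ := h
  obtain ⟨-, w, hw, hwu, -⟩ := parentSeq_some hpr hI hp hu
  have hwu' : w <+: u := (List.prefix_append _ _).trans hwu
  refine ⟨w, hw, v, hv, ?_⟩
  rcases huv with h | h
  · exact .inl (hwu'.trans h)
  · exact List.prefix_or_prefix_of_prefix hwu' h

lemma finite_infoSets (G : EFG) (i : Fin 2) : {I | G.InfoSet i I}.Finite := by
  refine (G.H.finite_toSet.image fun u => {v | G.sim i u v}).subset fun I hI => ?_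
  obtain ⟨u, hu⟩ := InfoSet.nonempty hI
  exact ⟨u, mem_H_of_mem_infoSet hI hu, (InfoSet.eq_of_mem hI hu).symm⟩

lemma finite_isSeq (G : EFG) (i : Fin 2) : {σ | G.IsSeq i σ}.Finite := by
  refine ((G.H.finite_toSet.image fun u : List ℕ =>
    (some ({v | G.sim i u.dropLast v}, u.getLastD 0) : SeqP)).insert none).subset ?_
  rintro σ (rfl | ⟨I, a, rfl, hI, u, hu, hua⟩)
  · exact Set.mem_insert _ _
  · exact Set.mem_insert_of_mem _ ⟨u ++ [a], hua, by simp [← hI.eq_of_mem hu]⟩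

lemma finite_idx (G : EFG) : Finite G.Idx :=
  Set.Finite.to_subtype (((G.finite_isSeq 0).prod (G.finite_isSeq 1)).subset
    fun _ hp => ⟨hp.1, hp.2.1⟩)

/-- The forest of information sets of a player. -/
noncomputable def infoForest (G : EFG) (hpr : G.PerfectRecall) (i : Fin 2) :
    InfoForest (Set (List ℕ)) where
  nodes := {I | G.InfoSet i I}
  finite_nodes := G.finite_infoSets i
  act I := {a | ∃ u ∈ I, u ++ [a] ∈ G.H}
  par := G.parentSeq i
  depth I := if h : I.Nonempty then (G.playerSeq i h.some).length else 0
  depth_of_par_none I hI hp := by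
    have hne := InfoSet.nonempty hI
    rw [dif_pos hne, playerSeq_of_parentSeq_none hpr hI hp hne.some_mem, List.length_nil]
  of_par_some I hI K c hp := by
    have hne := InfoSet.nonempty hI
    obtain ⟨hK, w, hw, -, hwc, hs⟩ := parentSeq_some hpr hI hp hne.some_mem
    have hne' := InfoSet.nonempty hK
    refine ⟨hK, ⟨w, hw, hwc⟩, ?_⟩
    rw [dif_pos hne, dif_pos hne', hs, List.length_append, List.length_singleton,
      hpr i _ _ (hK.sim hw hne'.some_mem)]

lemma isSeq_infoForest (hpr : G.PerfectRecall) {i : Fin 2} {σ : SeqP} :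
    (G.infoForest hpr i).IsSeq σ ↔ G.IsSeq i σ := by
  constructor
  · intro h
    rcases σ with _ | ⟨I, a⟩
    · exact .inl rfl
    · exact .inr ⟨I, a, rfl, h I a rfl⟩
  · rintro (rfl | ⟨I, a, rfl, h⟩)
    · rintro _ _ ⟨⟩
    · rintro _ _ ⟨⟩
      exact h

lemma isSeq_parentSeq (hpr : G.PerfectRecall) {i : Fin 2} {I : Set (List ℕ)}
    (hI : G.InfoSet i I) : G.IsSeq i (G.parentSeq i I) :=
  (isSeq_infoForest hpr).1 (InfoForest.isSeq_par (F := G.infoForest hpr i) hI)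

lemma exists_mem_iff_mem_actions {i : Fin 2} {I : Set (List ℕ)} (hI : G.InfoSet i I)
    {u : List ℕ} (hu : u ∈ I) {a : ℕ} : (∃ v ∈ I, v ++ [a] ∈ G.H) ↔ a ∈ G.actions u := by
  rw [mem_actions]
  exact ⟨fun ⟨v, hv, h⟩ => (G.sim_actions i v u (hI.sim hv hu) a).1 h, fun h => ⟨u, hu, h⟩⟩

/-- Being consistent with a path to `I` only depends on the parent sequence of `I`. -/
lemma forall_mem_playerSeq_iff (hpr : G.PerfectRecall) {i : Fin 2} {π : PlanT}
    (hπ : ∀ I, G.InfoSet i I → (π I).isSome = true → InfoForest.Plays π (G.parentSeq i I))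
    {I : Set (List ℕ)} (hI : G.InfoSet i I) :
    (∀ u ∈ I, ∀ p ∈ G.playerSeq i u, π p.1 = some p.2) ↔
      InfoForest.Plays π (G.parentSeq i I) := by
  constructor
  · intro h K c hp
    obtain ⟨u, hu⟩ := hI.nonempty
    obtain ⟨-, w, -, -, -, hs⟩ := parentSeq_some hpr hI hp hu
    exact h u hu (K, c) (by simp [hs])
  · intro h u hu
    induction hn : (G.playerSeq i u).length generalizing I u with
    | zero => simp [List.length_eq_zero_iff.1 hn]
    | succ n ih =>
      rcases hp : G.parentSeq i I with _ | ⟨K, c⟩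
      · simp [playerSeq_of_parentSeq_none hpr hI hp hu]
      · obtain ⟨hK, w, hw, -, -, hs⟩ := parentSeq_some hpr hI hp hu
        have hKc := h K c hp
        intro p hmem
        rw [hs, List.mem_append, List.mem_singleton] at hmem
        rcases hmem with hmem | rfl
        · exact ih hK (hπ K hK (by simp [hKc])) w hw (by simp [hs] at hn; exact hn) p hmem
        · exact hKc

lemma isSome_iff_plays (hpr : G.PerfectRecall) {i : Fin 2} {π : PlanT} (hπ : G.IsPlan i π)
    {I : Set (List ℕ)} (hI : G.InfoSet i I) :
    (π I).isSome = true ↔ InfoForest.Plays π (G.parentSeq i I) := by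
  have key : ∀ I, G.InfoSet i I → (π I).isSome = true →
      InfoForest.Plays π (G.parentSeq i I) := by
    intro I hI h K c hp
    obtain ⟨u, hu⟩ := hI.nonempty
    obtain ⟨-, w, -, -, -, hs⟩ := parentSeq_some hpr hI hp hu
    exact (hπ.2.1 I hI).1 h u hu (K, c) (by simp [hs])
  rw [hπ.2.1 I hI, forall_mem_playerSeq_iff hpr key hI]

lemma isPlan_of_complete (hpr : G.PerfectRecall) {i : Fin 2} {π : PlanT}
    (hπ : (G.infoForest hpr i).IsPartialPlan π)
    (hc : ∀ I, ¬ (G.infoForest hpr i).IsFrontier π I) : G.IsPlan i π := by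
  have key : ∀ I, G.InfoSet i I → (π I).isSome = true →
      InfoForest.Plays π (G.parentSeq i I) := by
    intro I _ h
    obtain ⟨a, ha⟩ := Option.isSome_iff_exists.1 h
    exact (hπ I a ha).2.2
  refine ⟨fun I hI => ?_, fun I hI => ?_, fun I a _ ha => (hπ I a ha).2.1⟩
  · by_contra hne
    obtain ⟨a, ha⟩ := Option.ne_none_iff_exists'.1 hne
    exact hI (hπ I a ha).1
  · rw [forall_mem_playerSeq_iff hpr key hI]
    refine ⟨key I hI, fun h => ?_⟩
    by_contra hne
    exact hc I ⟨hI, by simpa using hne, h⟩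

lemma mem_planSet_iff {i : Fin 2} {π : PlanT} {σ : SeqP} :
    π ∈ G.PlanSet i σ ↔ G.IsPlan i π ∧ InfoForest.Plays π σ := by
  rcases σ with _ | ⟨I, a⟩
  · simp [PlanSet, InfoForest.Plays]
  · simp [PlanSet, InfoForest.Plays]

end EFG

namespace EFG

variable {G : EFG}

/-- The von Stengel–Forges constraints without the normalization. -/
def IsFlow (G : EFG) (v : G.Idx → ℝ) : Prop :=
  (∀ p, 0 ≤ v p) ∧
    (∀ I₁, G.InfoSet 0 I₁ → ∀ σ₂, G.IsSeq 1 σ₂ → RelFor₁ σ₂ I₁ → ∀ u ∈ I₁,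
      ∑ a ∈ G.actions u, G.val v (some (I₁, a)) σ₂ = G.val v (G.parentSeq 0 I₁) σ₂) ∧
    (∀ I₂, G.InfoSet 1 I₂ → ∀ σ₁, G.IsSeq 0 σ₁ → RelFor₂ σ₁ I₂ → ∀ u ∈ I₂,
      ∑ a ∈ G.actions u, G.val v σ₁ (some (I₂, a)) = G.val v σ₁ (G.parentSeq 1 I₂))

lemma mem_VSF_iff {v : G.Idx → ℝ} : v ∈ G.VSF ↔ G.IsFlow v ∧ G.val v none none = 1 := by
  simp only [VSF, IsFlow, Set.mem_ofPred_eq]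
  tauto

lemma relPair_none_none : G.RelPair none none := ⟨.inl rfl, .inl rfl, .inl rfl⟩

lemma val_of_relPair (v : G.Idx → ℝ) {σ τ : SeqP} (h : G.RelPair σ τ) :
    G.val v σ τ = v ⟨(σ, τ), h⟩ := dif_pos h

lemma val_nonneg {v : G.Idx → ℝ} (hv : ∀ p, 0 ≤ v p) (σ τ : SeqP) : 0 ≤ G.val v σ τ := by
  unfold val
  split_ifs
  exacts [hv _, le_rfl]

lemma relFor₁_iff {I : Set (List ℕ)} {τ : SeqP} :
    RelFor₁ τ I ↔ ∀ J b, τ = some (J, b) → Connected I J := by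
  rcases τ with _ | ⟨J, b⟩
  · simp [RelFor₁]
  · constructor
    · rintro (h | ⟨_, _, ⟨⟩, h⟩) _ _ ⟨⟩
      · cases h
      · exact h
    · exact fun h => .inr ⟨J, b, rfl, h J b rfl⟩

lemma relFor₂_iff {J : Set (List ℕ)} {σ : SeqP} :
    RelFor₂ σ J ↔ ∀ I a, σ = some (I, a) → Connected I J := by
  rcases σ with _ | ⟨I, a⟩
  · simp [RelFor₂]
  · constructor
    · rintro (h | ⟨_, _, ⟨⟩, h⟩) _ _ ⟨⟩
      · cases h
      · exact h
    · exact fun h => .inr ⟨I, a, rfl, h I a rfl⟩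

lemma relPair_iff {σ τ : SeqP} : G.RelPair σ τ ↔ G.IsSeq 0 σ ∧ G.IsSeq 1 τ ∧
    ∀ I a J b, σ = some (I, a) → τ = some (J, b) → Connected I J := by
  unfold RelPair
  rcases σ with _ | ⟨I, a⟩ <;> rcases τ with _ | ⟨J, b⟩
  · simp
  · simp
  · simp
  · refine and_congr_right' (and_congr_right' ⟨?_, fun h => ?_⟩)
    · rintro (h | h | ⟨_, _, _, _, ⟨⟩, ⟨⟩, h⟩) _ _ _ _ ⟨⟩ ⟨⟩
      · cases h
      · cases h
      · exact h
    · exact .inr (.inr ⟨I, a, J, b, rfl, rfl, h I a J b rfl rfl⟩)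

/-- The plan pairs compatible with the sequence pair `p`. -/
def Compat (G : EFG) (p : SeqP × SeqP) : Set (PlanT × PlanT) :=
  {q | q.1 ∈ G.PlanSet 0 p.1 ∧ q.2 ∈ G.PlanSet 1 p.2}

lemma corrMap_eq_sum {μ : PlanT × PlanT → ℝ} (hμ : μ.support.Finite) (p : G.Idx) :
    G.corrMap μ p = ∑ q ∈ hμ.toFinset, if q ∈ G.Compat p then μ q else 0 := by
  change ∑ᶠ q ∈ G.Compat p, μ q = _
  rw [finsum_mem_def, finsum_eq_sum_of_support_subset]
  · rfl
  · rw [Set.Finite.coe_toFinset]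
    exact Set.support_indicator.subset.trans Set.inter_subset_right

/-- A finitely supported nonnegative measure on pairs of plans. -/
def IsMeas (G : EFG) (μ : PlanT × PlanT → ℝ) : Prop :=
  (∀ q, 0 ≤ μ q) ∧ (Function.support μ).Finite ∧
    ∀ q, μ q ≠ 0 → G.IsPlan 0 q.1 ∧ G.IsPlan 1 q.2

lemma corrMap_none_none {μ : PlanT × PlanT → ℝ} (hμ : G.IsMeas μ) :
    G.val (G.corrMap μ) none none = ∑ᶠ q, μ q := by
  rw [val_of_relPair _ relPair_none_none]
  refine finsum_congr fun q => ?_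
  by_cases hq : μ q = 0
  · simp [hq]
  · rw [finsum_eq_if, if_pos]
    exact hμ.2.2 q hq

/-- At an information set, the plans playing the parent sequence are split by the actions. -/
lemma sum_ite_mem_planSet (hpr : G.PerfectRecall) {i : Fin 2} {π : PlanT} (hπ : G.IsPlan i π)
    {I : Set (List ℕ)} (hI : G.InfoSet i I) {u : List ℕ} (hu : u ∈ I) (x : ℝ) :
    (∑ a ∈ G.actions u, if π ∈ G.PlanSet i (some (I, a)) then x else 0) =
      if π ∈ G.PlanSet i (G.parentSeq i I) then x else 0 := by
  have h : π ∈ G.PlanSet i (G.parentSeq i I) ↔ (π I).isSome = true := by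
    rw [mem_planSet_iff, isSome_iff_plays hpr hπ hI, and_iff_right hπ]
  have h' : ∀ a, π ∈ G.PlanSet i (some (I, a)) ↔ π I = some a := fun a => and_iff_right hπ
  simp only [h, h']
  rcases ha : π I with _ | a
  · simp
  · have hmem := (exists_mem_iff_mem_actions hI hu).1 (hπ.2.2 I a hI ha)
    simp [hmem]

lemma relPair_action_left {I : Set (List ℕ)} (hI : G.InfoSet 0 I) {τ : SeqP} (hτ : G.IsSeq 1 τ)
    (hR : RelFor₁ τ I) {u : List ℕ} (hu : u ∈ I) {a : ℕ} (ha : a ∈ G.actions u) :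
    G.RelPair (some (I, a)) τ :=
  relPair_iff.2 ⟨.inr ⟨I, a, rfl, hI, u, hu, mem_actions.1 ha⟩, hτ, by
    rintro _ _ J b ⟨⟩ e
    exact relFor₁_iff.1 hR J b e⟩

lemma relPair_action_right {J : Set (List ℕ)} (hJ : G.InfoSet 1 J) {σ : SeqP} (hσ : G.IsSeq 0 σ)
    (hR : RelFor₂ σ J) {u : List ℕ} (hu : u ∈ J) {b : ℕ} (hb : b ∈ G.actions u) :
    G.RelPair σ (some (J, b)) :=
  relPair_iff.2 ⟨hσ, .inr ⟨J, b, rfl, hJ, u, hu, mem_actions.1 hb⟩, by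
    rintro I a _ _ e ⟨⟩
    exact relFor₂_iff.1 hR I a e⟩

lemma relPair_parent_left (hpr : G.PerfectRecall) {I : Set (List ℕ)} (hI : G.InfoSet 0 I)
    {τ : SeqP} (hτ : G.IsSeq 1 τ) (hR : RelFor₁ τ I) : G.RelPair (G.parentSeq 0 I) τ :=
  relPair_iff.2 ⟨isSeq_parentSeq hpr hI, hτ, fun _ _ J b e e' =>
    connected_parent hpr hI e (relFor₁_iff.1 hR J b e')⟩

lemma relPair_parent_right (hpr : G.PerfectRecall) {J : Set (List ℕ)} (hJ : G.InfoSet 1 J)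
    {σ : SeqP} (hσ : G.IsSeq 0 σ) (hR : RelFor₂ σ J) : G.RelPair σ (G.parentSeq 1 J) :=
  relPair_iff.2 ⟨hσ, isSeq_parentSeq hpr hJ, fun I a _ _ e e' =>
    connected_symm (connected_parent hpr hJ e' (connected_symm (relFor₂_iff.1 hR I a e)))⟩

lemma isFlow_corrMap (hpr : G.PerfectRecall) {μ : PlanT × PlanT → ℝ} (hμ : G.IsMeas μ) :
    G.IsFlow (G.corrMap μ) := by
  refine ⟨fun p => ?_, fun I hI τ hτ hR u hu => ?_, fun J hJ σ hσ hR u hu => ?_⟩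
  · rw [corrMap_eq_sum hμ.2.1]
    refine Finset.sum_nonneg fun q _ => ?_
    split_ifs
    exacts [hμ.1 q, le_rfl]
  · rw [val_of_relPair _ (relPair_parent_left hpr hI hτ hR), corrMap_eq_sum hμ.2.1]
    have : ∀ a ∈ G.actions u, G.val (G.corrMap μ) (some (I, a)) τ =
        ∑ q ∈ hμ.2.1.toFinset, if q ∈ G.Compat (some (I, a), τ) then μ q else 0 := by
      intro a ha
      rw [val_of_relPair _ (relPair_action_left hI hτ hR hu ha), corrMap_eq_sum hμ.2.1]
    rw [Finset.sum_congr rfl this, Finset.sum_comm]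
    refine Finset.sum_congr rfl fun q hq => ?_
    have hq' := hμ.2.2 q (by simpa using hq)
    by_cases hc : q.2 ∈ G.PlanSet 1 τ
    · simpa [Compat, hc] using sum_ite_mem_planSet hpr hq'.1 hI hu (μ q)
    · simp [Compat, hc]
  · rw [val_of_relPair _ (relPair_parent_right hpr hJ hσ hR), corrMap_eq_sum hμ.2.1]
    have : ∀ b ∈ G.actions u, G.val (G.corrMap μ) σ (some (J, b)) =
        ∑ q ∈ hμ.2.1.toFinset, if q ∈ G.Compat (σ, some (J, b)) then μ q else 0 := by
      intro b hb
      rw [val_of_relPair _ (relPair_action_right hJ hσ hR hu hb), corrMap_eq_sum hμ.2.1]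
    rw [Finset.sum_congr rfl this, Finset.sum_comm]
    refine Finset.sum_congr rfl fun q hq => ?_
    have hq' := hμ.2.2 q (by simpa using hq)
    by_cases hc : q.1 ∈ G.PlanSet 0 σ
    · simpa [Compat, hc] using sum_ite_mem_planSet hpr hq'.2 hJ hu (μ q)
    · simp [Compat, hc]

/-- The support of a flow, viewed on the pair of forests of information sets. -/
noncomputable def forestPair (hpr : G.PerfectRecall) (htf : G.TriangleFree) {v : G.Idx → ℝ}
    (hv : G.IsFlow v) : ForestPair (Set (List ℕ)) (Set (List ℕ)) where
  L := G.infoForest hpr 0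
  M := G.infoForest hpr 1
  R := Connected
  R_left I hI K c J hp h := connected_parent hpr hI hp h
  R_right J hJ K c I hp h := connected_symm (connected_parent hpr hJ hp (connected_symm h))
  triangleFree I₁ hI₁ I₂ hI₂ J₁ hJ₁ J₂ hJ₂ hI hJ h₁ h₂ h₃ := by
    by_contra! hne
    exact htf ⟨I₁, I₂, J₁, J₂, hI₁, hI₂, hJ₁, hJ₂, hne.1, hne.2, hI, hJ, h₁, h₂, h₃⟩
  S σ τ := 0 < G.val v σ τ
  S_left I hI τ hτ hR := by
    obtain ⟨u, hu⟩ := InfoSet.nonempty hI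
    change 0 < G.val v (G.parentSeq 0 I) τ ↔ _
    rw [← hv.2.1 I hI τ ((isSeq_infoForest hpr).1 hτ) (relFor₁_iff.2 hR) u hu,
      Finset.sum_pos_iff_of_nonneg fun a _ => val_nonneg hv.1 _ _]
    exact exists_congr fun a => and_congr_left' (exists_mem_iff_mem_actions hI hu).symm
  S_right J hJ σ hσ hR := by
    obtain ⟨u, hu⟩ := InfoSet.nonempty hJ
    change 0 < G.val v σ (G.parentSeq 1 J) ↔ _
    rw [← hv.2.2 J hJ σ ((isSeq_infoForest hpr).1 hσ) (relFor₂_iff.2 hR) u hu,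
      Finset.sum_pos_iff_of_nonneg fun a _ => val_nonneg hv.1 _ _]
    exact exists_congr fun a => and_congr_left' (exists_mem_iff_mem_actions hJ hu).symm

/-- A nonzero flow is positive at all sequence pairs played by some pair of plans. -/
lemma IsFlow.exists_plans (hpr : G.PerfectRecall) (htf : G.TriangleFree) {v : G.Idx → ℝ}
    (hv : G.IsFlow v) (hne : v ≠ 0) :
    ∃ q : PlanT × PlanT, G.IsPlan 0 q.1 ∧ G.IsPlan 1 q.2 ∧
      ∀ p : G.Idx, q ∈ G.Compat p → 0 < v p := by
  obtain ⟨⟨⟨σ, τ⟩, hp⟩, hvp⟩ := Function.ne_iff.1 hne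
  obtain ⟨hσ, hτ, hR⟩ := relPair_iff.1 hp
  have hpos : 0 < G.val v σ τ := by
    rw [val_of_relPair v hp]
    exact lt_of_le_of_ne (hv.1 _) (Ne.symm hvp)
  obtain ⟨π, ρ, hs, hL, hM⟩ := ForestPair.exists_supported_plans
    (ForestPair.S_none_none (P := forestPair hpr htf hv) ((isSeq_infoForest hpr).2 hσ)
      ((isSeq_infoForest hpr).2 hτ) hR hpos)
  refine ⟨(π, ρ), isPlan_of_complete hpr hs.left hL, isPlan_of_complete hpr hs.right hM, ?_⟩
  rintro ⟨⟨σ', τ'⟩, hp'⟩ ⟨h₁, h₂⟩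
  have := hs.supported σ' τ' (mem_planSet_iff.1 h₁).2 (mem_planSet_iff.1 h₂).2
    (relPair_iff.1 hp').2.2
  change 0 < G.val v σ' τ' at this
  rwa [val_of_relPair v hp'] at this

lemma isMeas_smul_pointMass {q : PlanT × PlanT} (h₀ : G.IsPlan 0 q.1) (h₁ : G.IsPlan 1 q.2)
    {ε : ℝ} (hε : 0 ≤ ε) : G.IsMeas (ε • pointMass q) := by
  refine ⟨fun r => ?_, (Set.finite_singleton q).subset fun r hr => ?_, fun r hr => ?_⟩
  · by_cases h : r = q <;> simp [pointMass, h, hε]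
  · by_contra h
    exact hr (by simp [pointMass, show r ≠ q from h])
  · by_cases h : r = q
    · rw [h]
      exact ⟨h₀, h₁⟩
    · simp [pointMass, h] at hr

lemma corrMap_smul_pointMass (q : PlanT × PlanT) (ε : ℝ) (p : G.Idx) :
    G.corrMap (ε • pointMass q) p = if q ∈ G.Compat p then ε else 0 := by
  change ∑ᶠ r ∈ G.Compat p, (ε • pointMass q) r = _
  rw [finsum_mem_def, finsum_eq_single _ q fun r hr => by simp [pointMass, hr]]
  simp [Set.indicator_apply, pointMass]

lemma IsMeas.add {μ ν : PlanT × PlanT → ℝ} (hμ : G.IsMeas μ) (hν : G.IsMeas ν) :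
    G.IsMeas (μ + ν) := by
  refine ⟨fun q => add_nonneg (hμ.1 q) (hν.1 q),
    (hμ.2.1.union hν.2.1).subset (Function.support_add μ ν), fun q hq => ?_⟩
  by_cases h : μ q = 0
  · exact hν.2.2 q fun h' => hq (by simp [h, h'])
  · exact hμ.2.2 q h

lemma corrMap_add {μ ν : PlanT × PlanT → ℝ} (hμ : G.IsMeas μ) (hν : G.IsMeas ν) :
    G.corrMap (μ + ν) = G.corrMap μ + G.corrMap ν := by
  funext p
  exact finsum_mem_add_distrib' (hμ.2.1.inter_of_right _) (hν.2.1.inter_of_right _)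

lemma val_sub (v w : G.Idx → ℝ) (σ τ : SeqP) : G.val (v - w) σ τ = G.val v σ τ - G.val w σ τ := by
  unfold val
  split_ifs <;> simp

lemma IsFlow.sub {v w : G.Idx → ℝ} (hv : G.IsFlow v) (hw : G.IsFlow w) (hle : w ≤ v) :
    G.IsFlow (v - w) := by
  refine ⟨fun p => sub_nonneg.2 (hle p), fun I hI τ hτ hR u hu => ?_, fun J hJ σ hσ hR u hu => ?_⟩
  · simp only [val_sub, Finset.sum_sub_distrib]
    rw [hv.2.1 I hI τ hτ hR u hu, hw.2.1 I hI τ hτ hR u hu]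
  · simp only [val_sub, Finset.sum_sub_distrib]
    rw [hv.2.2 J hJ σ hσ hR u hu, hw.2.2 J hJ σ hσ hR u hu]

/-- Every flow is induced by a measure on pairs of plans. -/
lemma IsFlow.exists_corrMap_eq (hpr : G.PerfectRecall) (htf : G.TriangleFree) {v : G.Idx → ℝ}
    (hv : G.IsFlow v) : ∃ μ, G.IsMeas μ ∧ v = G.corrMap μ := by
  have := G.finite_idx
  induction hn : v.support.ncard using Nat.strong_induction_on generalizing v with
  | _ n ih =>
    by_cases hne : v = 0
    · refine ⟨0, ⟨fun _ => le_rfl, by simp, fun q hq => absurd rfl hq⟩, ?_⟩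
      funext p
      simp [hne, corrMap]
    · obtain ⟨q, h₀, h₁, hpos⟩ := hv.exists_plans hpr htf hne
      have hcne : {p : G.Idx | q ∈ G.Compat p}.Nonempty :=
        ⟨⟨(none, none), relPair_none_none⟩, h₀, h₁⟩
      obtain ⟨p₀, hp₀, hmin⟩ := Set.exists_min_image _ v (Set.toFinite _) hcne
      have hmeas : G.IsMeas (v p₀ • pointMass q) := isMeas_smul_pointMass h₀ h₁ (hv.1 p₀)
      have hle : G.corrMap (v p₀ • pointMass q) ≤ v := by
        intro p
        rw [corrMap_smul_pointMass]
        split_ifs with hp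
        exacts [hmin p hp, hv.1 p]
      have hlt : (v - G.corrMap (v p₀ • pointMass q)).support.ncard < n := by
        rw [← hn]
        refine Set.ncard_lt_ncard ⟨fun p hp => ?_, fun hss => ?_⟩ (Set.toFinite _)
        · intro hvp
          have := hle p
          have := (isFlow_corrMap hpr hmeas).1 p
          exact hp (by rw [Pi.sub_apply]; linarith)
        · exact hss (show p₀ ∈ v.support from (hpos p₀ hp₀).ne')
            (by rw [Pi.sub_apply, corrMap_smul_pointMass, if_pos (show q ∈ G.Compat p₀ from hp₀), sub_self])
      obtain ⟨μ, hμ, hvμ⟩ := ih _ hlt (hv.sub (isFlow_corrMap hpr hmeas) hle) rfl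
      exact ⟨_, hμ.add hmeas, by rw [corrMap_add hμ hmeas, ← hvμ, sub_add_cancel]⟩

end EFG

/-- In a two-player perfect-recall triangle-free extensive-form game,
the polytope of correlation plans coincides with the von Stengel–Forges polytope. -/
theorem corrPoly_eq_VSF_of_triangleFree (G : EFG) (hpr : G.PerfectRecall)
    (htf : G.TriangleFree) : G.corrPoly = G.VSF := by
  ext v
  rw [EFG.mem_VSF_iff]
  constructor
  · rintro ⟨μ, ⟨h₀, hfin, hplan, hsum⟩, rfl⟩
    have hμ : G.IsMeas μ := ⟨h₀, hfin, hplan⟩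
    exact ⟨EFG.isFlow_corrMap hpr hμ, by rw [EFG.corrMap_none_none hμ, hsum]⟩
  · rintro ⟨hv, hone⟩
    obtain ⟨μ, hμ, rfl⟩ := hv.exists_corrMap_eq hpr htf
    rw [EFG.corrMap_none_none hμ] at hone
    exact ⟨μ, ⟨hμ.1, hμ.2.1, hμ.2.2, hone⟩, rfl⟩
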